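/- arXiv:1801.01412 — 2 statements merged into one kernel-verified Lean document; each statement's English description precedes it below -/
import Mathlib

section
/- Suppose p ∈ ℤ^n and q ∈ ℤ^m have positive nonincreasing entries with Σ_j p_j = Σ_i q_i = N. Then the restricted capacity cap′(trun_{P,Q} T) := inf over h_0 ranging over invertible upper-triangular matrices in Mat_n(ℂ), with h = G_p(h_0), of det((trun_{P,Q} T)(h h†)) / det(h h†), equals the full Gurvits capacity cap(trun_{P,Q} T) := inf over positive-definite X ∈ Mat_N(ℂ) of det((trun_{P,Q} T)(X)) / det(X). -/
open Matrix BigOperators ComplexOrder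

noncomputable section

/-- `η_j` : the projection onto the first `j` coordinates, as a `j × k` matrix. -/
def proj (j k : ℕ) : Matrix (Fin j) (Fin k) ℂ :=
  Matrix.of fun i l => if (i : ℕ) = (l : ℕ) then 1 else 0

/-- `Δa_j = a_j − a_{j+1}`, with the convention `a_{k+1} = 0`. -/
def delta {k : ℕ} (a : Fin k → ℝ) (j : Fin k) : ℝ :=
  a j - (if h : (j : ℕ) + 1 < k then a ⟨(j : ℕ) + 1, h⟩ else 0)

/-- Integer version of `delta`. -/
def deltaNat {k : ℕ} (a : Fin k → ℕ) (j : Fin k) : ℕ :=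
  a j - (if h : (j : ℕ) + 1 < k then a ⟨(j : ℕ) + 1, h⟩ else 0)

/-- The relative determinant `det(diag a, X) = ∏_j det(η_j X η_j†)^{Δa_j}` (real exponents,
with the convention `0 ^ 0 = 1`). -/
def relDet {k : ℕ} (a : Fin k → ℝ) (X : Matrix (Fin k) (Fin k) ℂ) : ℝ :=
  ∏ j : Fin k,
    ((proj ((j : ℕ) + 1) k * X * (proj ((j : ℕ) + 1) k)ᴴ).det.re) ^ (delta a j)

/-- Complex relative determinant for integral weights. -/
def relDetC {k : ℕ} (a : Fin k → ℕ) (X : Matrix (Fin k) (Fin k) ℂ) : ℂ :=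
  ∏ j : Fin k,
    ((proj ((j : ℕ) + 1) k * X * (proj ((j : ℕ) + 1) k)ᴴ).det) ^ (deltaNat a j)

/-- The completely positive map `T(X) = Σ A_i X A_i†` with Kraus operators `A i`. -/
def cpMap {ι κ : Type*} [Fintype ι] {r : ℕ} (A : Fin r → Matrix κ ι ℂ)
    (X : Matrix ι ι ℂ) : Matrix κ κ ℂ :=
  ∑ i, A i * X * (A i)ᴴ

/-- The dual completely positive map `T*(Y) = Σ A_i† Y A_i`. -/
def cpDual {ι κ : Type*} [Fintype κ] {r : ℕ} (A : Fin r → Matrix κ ι ℂ)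
    (Y : Matrix κ κ ℂ) : Matrix ι ι ℂ :=
  ∑ i, (A i)ᴴ * Y * A i

/-- Frobenius norm `‖A‖ = √(Tr A Aᴴ)`. -/
def frob {ι κ : Type*} [Fintype ι] [Fintype κ] (A : Matrix ι κ ℂ) : ℝ :=
  Real.sqrt (A * Aᴴ).trace.re

/-- Upper triangular predicate. -/
def UT {k : ℕ} (g : Matrix (Fin k) (Fin k) ℂ) : Prop :=
  ∀ i j : Fin k, j < i → g i j = 0

/-- Capacity with specified marginals:
`cap(T,P,Q) = inf over invertible upper triangular h of det(Q, T(hPh†)) / det(P, h†h)`. -/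
def cap {n m r : ℕ} (A : Fin r → Matrix (Fin m) (Fin n) ℂ)
    (p : Fin n → ℝ) (q : Fin m → ℝ) : ℝ :=
  sInf { x : ℝ | ∃ h : Matrix (Fin n) (Fin n) ℂ, IsUnit h.det ∧ UT h ∧
    x = relDet q (cpMap A (h * Matrix.diagonal (fun j => (p j : ℂ)) * hᴴ)) /
        relDet p (hᴴ * h) }

/-- Span of the first `i` standard basis vectors of `ℂ^k`. -/
def coordSub (k i : ℕ) : Submodule ℂ (Fin k → ℂ) where
  carrier := { x | ∀ l : Fin k, i ≤ (l : ℕ) → x l = 0 }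
  add_mem' := by intro a b ha hb l hl; simp [ha l hl, hb l hl]
  zero_mem' := by intro l _; rfl
  smul_mem' := by intro c x hx l hl; simp [hx l hl]

/-- `(L, R)` is a `T`-independent pair: `A_i R ⊥ L` for all `i`. -/
def TIndep {n m r : ℕ} (A : Fin r → Matrix (Fin m) (Fin n) ℂ)
    (L : Submodule ℂ (Fin m → ℂ)) (R : Submodule ℂ (Fin n → ℂ)) : Prop :=
  ∀ i : Fin r, ∀ x ∈ R, ∀ y ∈ L, star y ⬝ᵥ (A i).mulVec x = 0

/-- `(P,Q)`-rank-nondecreasingness. -/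
def rankNonDec {n m r : ℕ} (A : Fin r → Matrix (Fin m) (Fin n) ℂ)
    (p : Fin n → ℝ) (q : Fin m → ℝ) : Prop :=
  ∀ L : Submodule ℂ (Fin m → ℂ), ∀ R : Submodule ℂ (Fin n → ℂ), TIndep A L R →
    (∑ i : Fin m, delta q i * (Module.finrank ℂ ↥(coordSub m ((i : ℕ) + 1) ⊓ L) : ℝ)) +
      (∑ j : Fin n, delta p j * (Module.finrank ℂ ↥(coordSub n ((j : ℕ) + 1) ⊓ R) : ℝ))
      ≤ ∑ j, p j

/-- `λ'_{i+1}`: number of parts of `lam` that are `> i` (0-indexed conjugate partition). -/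
def conj' {k : ℕ} (lam : Fin k → ℕ) (i : ℕ) : ℕ :=
  (Finset.univ.filter fun j : Fin k => i < lam j).card

lemma conj'_le {k : ℕ} (lam : Fin k → ℕ) (i : ℕ) : conj' lam i ≤ k := by
  classical
  calc conj' lam i ≤ Finset.univ.card := Finset.card_filter_le _ _
    _ = k := by simp

/-- Index set for the blocks of `G_λ`; it has cardinality `Σ_i λ'_i = Σ_j λ_j`. -/
abbrev lamIdx {k : ℕ} (lam : Fin k → ℕ) : Type :=
  Σ i : Fin (Finset.univ.sup lam), Fin (conj' lam (i : ℕ))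

/-- The gadget map `G_λ(X) = ⊕_{i=1}^{λ_1} η_{λ'_i} X η_{λ'_i}†`. -/
def Gmap {k : ℕ} (lam : Fin k → ℕ) (X : Matrix (Fin k) (Fin k) ℂ) :
    Matrix (lamIdx lam) (lamIdx lam) ℂ := fun s t =>
  if s.1 = t.1 then
    X (Fin.castLE (conj'_le lam (s.1 : ℕ)) s.2) (Fin.castLE (conj'_le lam (t.1 : ℕ)) t.2)
  else 0

/-- The adjoint `G_λ*` of the gadget map with respect to the trace inner product. -/
def GmapAdj {k : ℕ} (lam : Fin k → ℕ) (Y : Matrix (lamIdx lam) (lamIdx lam) ℂ) :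
    Matrix (Fin k) (Fin k) ℂ := fun a b =>
  ∑ i : Fin (Finset.univ.sup lam),
    if h : (a : ℕ) < conj' lam (i : ℕ) ∧ (b : ℕ) < conj' lam (i : ℕ) then
      Y ⟨i, ⟨(a : ℕ), h.1⟩⟩ ⟨i, ⟨(b : ℕ), h.2⟩⟩
    else 0

/-- The reduction `trun_{P,Q} T = G_q ∘ T ∘ G_p*`. -/
def trun {n m r : ℕ} (A : Fin r → Matrix (Fin m) (Fin n) ℂ) (p : Fin n → ℕ) (q : Fin m → ℕ)
    (X : Matrix (lamIdx p) (lamIdx p) ℂ) : Matrix (lamIdx q) (lamIdx q) ℂ :=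
  Gmap q (cpMap A (GmapAdj p X))

/-- The dual of the reduction: `(trun_{P,Q} T)* = G_p ∘ T* ∘ G_q*`. -/
def trunDual {n m r : ℕ} (A : Fin r → Matrix (Fin m) (Fin n) ℂ) (p : Fin n → ℕ) (q : Fin m → ℕ)
    (Y : Matrix (lamIdx q) (lamIdx q) ℂ) : Matrix (lamIdx p) (lamIdx p) ℂ :=
  Gmap p (cpDual A (GmapAdj q Y))

/-- Shannon entropy with convention `0 · log 0 = 0` (note `Real.log 0 = 0`). -/
def entropy {k : ℕ} (p : Fin k → ℝ) : ℝ := -∑ j, p j * Real.log (p j)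

/-- The distance-to-target measure `ds_{P,Q}(T)`. -/
def ds {n m r : ℕ} (A : Fin r → Matrix (Fin m) (Fin n) ℂ)
    (p : Fin n → ℝ) (q : Fin m → ℝ) : ℝ :=
  (∑ j : Fin n, delta p j *
      (frob (proj ((j : ℕ) + 1) n *
        (cpDual A (Matrix.diagonal fun i => (q i : ℂ)) - 1) * (proj ((j : ℕ) + 1) n)ᴴ)) ^ 2) +
    ∑ i : Fin m, delta q i *
      (frob (proj ((i : ℕ) + 1) m *
        (cpMap A (Matrix.diagonal fun j => (p j : ℂ)) - 1) * (proj ((i : ℕ) + 1) m)ᴴ)) ^ 2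

/-- `(u_1,…,u_n)` can be approximately put in `Q`-isotropic position with respect to `p`. -/
def approxIso {m n : ℕ} (u : Fin n → Fin m → ℂ) (p : Fin n → ℝ)
    (Q : Matrix (Fin m) (Fin m) ℂ) : Prop :=
  ∀ ε : ℝ, 0 < ε → ∃ B : Matrix (Fin m) (Fin m) ℂ, IsUnit B.det ∧
    frob ((∑ i : Fin n,
      (((p i / ∑ a, Complex.normSq (B.mulVec (u i) a)) : ℝ) : ℂ) •
        Matrix.vecMulVec (B.mulVec (u i)) (star (B.mulVec (u i)))) - Q) ≤ ε

/-- The `i`-th block embedding `V_i`, so that `G_λ(X) = Σ V_i† X V_i` and `G_λ*(Y) = Σ V_i Y V_i†`. -/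
def blockEmb {k : ℕ} (lam : Fin k → ℕ) (i : Fin (Finset.univ.sup lam)) :
    Matrix (Fin k) (lamIdx lam) ℂ :=
  Matrix.of fun a s => if s.1 = i ∧ Fin.castLE (conj'_le lam (s.1 : ℕ)) s.2 = a then 1 else 0

lemma blockEmb_apply_of_lt {k : ℕ} (lam : Fin k → ℕ) (i : Fin (Finset.univ.sup lam)) (a : Fin k)
    (h : (a : ℕ) < conj' lam (i : ℕ)) (s : lamIdx lam) :
    blockEmb lam i a s = if s = ⟨i, ⟨(a : ℕ), h⟩⟩ then 1 else 0 := by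
  obtain ⟨j, b⟩ := s
  simp only [blockEmb, Matrix.of_apply]
  congr 1
  rw [eq_iff_iff]
  constructor
  · rintro ⟨rfl, rfl⟩
    rfl
  · intro hs
    cases hs
    exact ⟨rfl, rfl⟩

lemma blockEmb_apply_of_not_lt {k : ℕ} (lam : Fin k → ℕ) (i : Fin (Finset.univ.sup lam))
    (a : Fin k) (h : ¬ (a : ℕ) < conj' lam (i : ℕ)) (s : lamIdx lam) :
    blockEmb lam i a s = 0 := by
  obtain ⟨j, b⟩ := s
  simp only [blockEmb, Matrix.of_apply]
  rw [if_neg]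
  rintro ⟨rfl, rfl⟩
  exact h b.2

lemma Gmap_eq_sum {k : ℕ} (lam : Fin k → ℕ) (X : Matrix (Fin k) (Fin k) ℂ) :
    Gmap lam X = ∑ i, (blockEmb lam i)ᴴ * X * blockEmb lam i := by
  ext s t
  simp only [Matrix.sum_apply, Matrix.mul_apply, Matrix.conjTranspose_apply, blockEmb,
    Matrix.of_apply, Gmap, apply_ite star, star_one, star_zero, ite_and, ite_mul, mul_ite,
    one_mul, zero_mul, mul_one, mul_zero]
  by_cases hst : s.1 = t.1
  · rw [Finset.sum_eq_single t.1]
    · simp [hst]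
    · intro i _ hi
      simp [Ne.symm hi]
    · simp
  · rw [if_neg hst, eq_comm]
    refine Finset.sum_eq_zero fun i _ => ?_
    by_cases hi : t.1 = i
    · subst hi
      simp [hst]
    · simp [hi]

lemma GmapAdj_eq_sum {k : ℕ} (lam : Fin k → ℕ) (Y : Matrix (lamIdx lam) (lamIdx lam) ℂ) :
    GmapAdj lam Y = ∑ i, blockEmb lam i * Y * (blockEmb lam i)ᴴ := by
  ext a b
  simp only [Matrix.sum_apply, GmapAdj]
  refine Finset.sum_congr rfl fun i _ => ?_
  simp only [Matrix.mul_apply, Matrix.conjTranspose_apply]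
  by_cases ha : (a : ℕ) < conj' lam (i : ℕ)
  · by_cases hb : (b : ℕ) < conj' lam (i : ℕ)
    · simp [blockEmb_apply_of_lt lam i a ha, blockEmb_apply_of_lt lam i b hb, ha, hb,
        apply_ite star]
    · simp [blockEmb_apply_of_not_lt lam i b hb, hb]
  · simp [blockEmb_apply_of_not_lt lam i a ha, ha]

lemma Gmap_one {k : ℕ} (lam : Fin k → ℕ) : Gmap lam 1 = 1 := by
  ext ⟨i, a⟩ ⟨j, b⟩
  by_cases hij : i = j
  · subst hij
    simp [Gmap, Matrix.one_apply]
  · simp [Gmap, hij]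

lemma UT.mul_blockEmb {k : ℕ} {h : Matrix (Fin k) (Fin k) ℂ} (hh : UT h) (lam : Fin k → ℕ)
    (i : Fin (Finset.univ.sup lam)) :
    h * blockEmb lam i = blockEmb lam i * Gmap lam h := by
  ext a s
  simp only [Matrix.mul_apply]
  have hl : ∑ c, h a c * blockEmb lam i c s =
      if s.1 = i then h a (Fin.castLE (conj'_le lam (s.1 : ℕ)) s.2) else 0 := by
    by_cases hs : s.1 = i <;> simp [blockEmb, hs]
  rw [hl]
  by_cases ha : (a : ℕ) < conj' lam (i : ℕ)
  · simp only [blockEmb_apply_of_lt lam i a ha, ite_mul, one_mul, zero_mul, Finset.sum_ite_eq',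
      Finset.mem_univ, if_true, Gmap, eq_comm (a := i)]
    rfl
  · simp only [blockEmb_apply_of_not_lt lam i a ha, zero_mul, Finset.sum_const_zero]
    split_ifs with hs
    · subst hs
      exact hh _ _ (Fin.lt_def.2 (lt_of_lt_of_le s.2.2 (not_lt.1 ha)))
    · rfl

lemma UT.Gmap_mul {k : ℕ} {h : Matrix (Fin k) (Fin k) ℂ} (lam : Fin k → ℕ)
    (g : Matrix (Fin k) (Fin k) ℂ) (hh : UT h) :
    Gmap lam (g * h) = Gmap lam g * Gmap lam h := by
  rw [Gmap_eq_sum lam (g * h), Gmap_eq_sum lam g, Finset.sum_mul]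
  refine Finset.sum_congr rfl fun i _ => ?_
  rw [Matrix.mul_assoc, Matrix.mul_assoc, Matrix.mul_assoc, hh.mul_blockEmb, Matrix.mul_assoc]

lemma UT.GmapAdj_conj {k : ℕ} {h : Matrix (Fin k) (Fin k) ℂ} (hh : UT h) (lam : Fin k → ℕ)
    (Y : Matrix (lamIdx lam) (lamIdx lam) ℂ) :
    GmapAdj lam (Gmap lam h * Y * (Gmap lam h)ᴴ) = h * GmapAdj lam Y * hᴴ := by
  rw [GmapAdj_eq_sum, GmapAdj_eq_sum, Finset.mul_sum, Finset.sum_mul]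
  refine Finset.sum_congr rfl fun i _ => ?_
  have e := hh.mul_blockEmb lam i
  calc blockEmb lam i * (Gmap lam h * Y * (Gmap lam h)ᴴ) * (blockEmb lam i)ᴴ
      = (blockEmb lam i * Gmap lam h) * Y * (blockEmb lam i * Gmap lam h)ᴴ := by
        simp only [Matrix.conjTranspose_mul, Matrix.mul_assoc]
    _ = h * (blockEmb lam i * Y * (blockEmb lam i)ᴴ) * hᴴ := by
        rw [← e]
        simp only [Matrix.conjTranspose_mul, Matrix.mul_assoc]

lemma trace_GmapAdj {k : ℕ} (lam : Fin k → ℕ) (Y : Matrix (lamIdx lam) (lamIdx lam) ℂ) :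
    (GmapAdj lam Y).trace = Y.trace := by
  have e : ∑ i, (blockEmb lam i)ᴴ * blockEmb lam i = 1 := by
    simpa using (Gmap_eq_sum lam 1).symm.trans (Gmap_one lam)
  calc (GmapAdj lam Y).trace
      = ((∑ i, (blockEmb lam i)ᴴ * blockEmb lam i) * Y).trace := by
        rw [GmapAdj_eq_sum, Finset.sum_mul, Matrix.trace_sum, Matrix.trace_sum]
        refine Finset.sum_congr rfl fun i _ => ?_
        rw [Matrix.trace_mul_comm, Matrix.mul_assoc]
    _ = Y.trace := by rw [e, Matrix.one_mul]

lemma Gmap_posSemidef {k : ℕ} (lam : Fin k → ℕ) {X : Matrix (Fin k) (Fin k) ℂ}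
    (hX : X.PosSemidef) : (Gmap lam X).PosSemidef := by
  rw [Gmap_eq_sum]
  exact Matrix.posSemidef_sum _ fun i _ => hX.conjTranspose_mul_mul_same _

lemma cpMap_posSemidef {n m r : ℕ} (A : Fin r → Matrix (Fin m) (Fin n) ℂ)
    {X : Matrix (Fin n) (Fin n) ℂ} (hX : X.PosSemidef) : (cpMap A X).PosSemidef :=
  Matrix.posSemidef_sum _ fun _ _ => hX.mul_mul_conjTranspose_same _

lemma GmapAdj_posDef {k : ℕ} (lam : Fin k → ℕ) (hlam : ∀ j, 0 < lam j)
    {Y : Matrix (lamIdx lam) (lamIdx lam) ℂ} (hY : Y.PosDef) : (GmapAdj lam Y).PosDef := by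
  rw [GmapAdj_eq_sum]
  rcases isEmpty_or_nonempty (Fin k) with hk | ⟨⟨j⟩⟩
  · refine Matrix.PosDef.of_dotProduct_mulVec_pos (Subsingleton.elim _ _) fun x hx => ?_
    exact absurd (Subsingleton.elim x 0) hx
  have hpos : 0 < Finset.univ.sup lam :=
    (hlam j).trans_le (Finset.le_sup (f := lam) (Finset.mem_univ j))
  set i₀ : Fin (Finset.univ.sup lam) := ⟨0, hpos⟩
  have hc : conj' lam (i₀ : ℕ) = k := by
    simp [conj', i₀, hlam]
  have hinj : blockEmb lam i₀ * (blockEmb lam i₀)ᴴ = 1 := by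
    ext a b
    have ha : (a : ℕ) < conj' lam (i₀ : ℕ) := a.2.trans_eq hc.symm
    have hb : (b : ℕ) < conj' lam (i₀ : ℕ) := b.2.trans_eq hc.symm
    simp [Matrix.mul_apply, blockEmb_apply_of_lt lam i₀ a ha, blockEmb_apply_of_lt lam i₀ b hb,
      Matrix.one_apply, apply_ite star, Fin.ext_iff, eq_comm (a := (b : ℕ))]
  rw [← Finset.add_sum_erase _ _ (Finset.mem_univ i₀)]
  refine Matrix.PosDef.add_posSemidef (hY.mul_mul_conjTranspose_same ?_)
    (Matrix.posSemidef_sum _ fun i _ => hY.posSemidef.mul_mul_conjTranspose_same _)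
  intro x y hxy
  simpa [Matrix.vecMul_vecMul, hinj] using congrArg (fun z => z ᵥ* (blockEmb lam i₀)ᴴ) hxy

lemma GmapAdj_one_eq_diagonal {k : ℕ} (lam : Fin k → ℕ) :
    GmapAdj lam 1 = Matrix.diagonal (GmapAdj lam 1).diag := by
  ext a b
  by_cases hab : a = b
  · simp [hab]
  · have hab' : (a : ℕ) ≠ b := fun h => hab (Fin.ext h)
    rw [Matrix.diagonal_apply_ne _ hab]
    refine Finset.sum_eq_zero fun i _ => ?_
    split_ifs with h
    · simp [hab']
    · rfl

/-- A positive definite matrix is congruent to any positive definite diagonal matrix through an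
invertible upper triangular matrix. -/
lemma exists_UT_conj_eq_diagonal {k : ℕ} {Z : Matrix (Fin k) (Fin k) ℂ} (hZ : Z.PosDef)
    {d : Fin k → ℂ} (hd : ∀ j, 0 < d j) :
    ∃ g : Matrix (Fin k) (Fin k) ℂ, IsUnit g.det ∧ UT g ∧ g * Z * gᴴ = Matrix.diagonal d := by
  have hS : (Z.submatrix Fin.rev Fin.rev).PosDef := hZ.submatrix Fin.rev_injective
  set L := LDL.lowerInv hS
  set U : Matrix (Fin k) (Fin k) ℂ := L.submatrix Fin.rev Fin.rev
  have hUdet : IsUnit U.det := by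
    have : U.det = L.det := Matrix.det_submatrix_equiv_self Fin.revPerm L
    rw [this]
    exact Matrix.isUnit_det_of_invertible L
  have hUT : UT U := fun i j hij => LDL.lowerInv_triangular hS (Fin.rev_lt_rev.2 hij)
  set e : Fin k → ℂ := fun j => LDL.diagEntries hS (Fin.rev j)
  have hconj : U * Z * Uᴴ = Matrix.diagonal e := by
    have h := congrArg (fun M => M.submatrix (Fin.revPerm (n := k)) (Fin.revPerm (n := k)))
      (LDL.diag_eq_lowerInv_conj hS)
    simp only [← Matrix.submatrix_mul_equiv _ _ _ (Fin.revPerm (n := k)), LDL.diag,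
      Matrix.submatrix_diagonal_equiv] at h
    have hZ' : (Z.submatrix Fin.rev Fin.rev).submatrix (Fin.revPerm (n := k))
        (Fin.revPerm (n := k)) = Z := by
      ext i j
      simp
    rw [hZ'] at h
    exact h.symm
  have hepos : ∀ j, 0 < e j := by
    have : (Matrix.diagonal e).PosDef := by
      rw [← hconj]
      refine hZ.mul_mul_conjTranspose_same ?_
      exact Matrix.vecMul_injective_of_isUnit ((Matrix.isUnit_iff_isUnit_det _).2 hUdet)
    exact Matrix.posDef_diagonal_iff.1 this
  set c : Fin k → ℝ := fun j => √((d j).re / (e j).re)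
  have hcpos : ∀ j, 0 < c j := fun j =>
    Real.sqrt_pos.2 (div_pos (Complex.pos_iff.1 (hd j)).1 (Complex.pos_iff.1 (hepos j)).1)
  refine ⟨Matrix.diagonal (fun j => (c j : ℂ)) * U, ?_, ?_, ?_⟩
  · rw [Matrix.det_mul, Matrix.det_diagonal]
    refine IsUnit.mul (IsUnit.mk0 _ (Finset.prod_ne_zero_iff.2 fun j _ => ?_)) hUdet
    exact_mod_cast (hcpos j).ne'
  · intro i j hij
    rw [Matrix.diagonal_mul, hUT i j hij, mul_zero]
  · rw [Matrix.conjTranspose_mul, Matrix.diagonal_conjTranspose]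
    calc _ = Matrix.diagonal (fun j => (c j : ℂ)) * (U * Z * Uᴴ) *
          Matrix.diagonal (star fun j => (c j : ℂ)) := by simp only [Matrix.mul_assoc]
      _ = Matrix.diagonal d := by
        rw [hconj, Matrix.diagonal_mul_diagonal, Matrix.diagonal_mul_diagonal]
        congr 1
        funext j
        have h1 : d j = ((d j).re : ℂ) := Complex.ext rfl (Complex.pos_iff.1 (hd j)).2.symm
        have h2 : e j = ((e j).re : ℂ) := Complex.ext rfl (Complex.pos_iff.1 (hepos j)).2.symm
        have h3 : c j * (e j).re * c j = (d j).re := by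
          rw [mul_right_comm, Real.mul_self_sqrt (div_nonneg (Complex.pos_iff.1 (hd j)).1.le
            (Complex.pos_iff.1 (hepos j)).1.le)]
          exact div_mul_cancel₀ _ (Complex.pos_iff.1 (hepos j)).1.ne'
        rw [h1, h2, ← h3]
        simp

lemma UT.inv {k : ℕ} {g : Matrix (Fin k) (Fin k) ℂ} (hg : UT g) (hdet : IsUnit g.det) :
    UT g⁻¹ := by
  let := Matrix.invertibleOfIsUnitDet g hdet
  have h : Matrix.BlockTriangular g id := fun i j hij => hg i j hij
  exact fun i j hij => Matrix.blockTriangular_inv_of_blockTriangular h hij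

lemma UT.isUnit_Gmap {k : ℕ} {g : Matrix (Fin k) (Fin k) ℂ} (hg : UT g) (hdet : IsUnit g.det)
    (lam : Fin k → ℕ) : IsUnit (Gmap lam g) := by
  refine IsUnit.of_mul_eq_one_right (Gmap lam g⁻¹) ?_
  rw [← hg.Gmap_mul, Matrix.nonsing_inv_mul _ hdet, Gmap_one]

/-- The arithmetic-geometric mean inequality for the spectrum of a positive definite matrix of
normalized trace one. -/
lemma Matrix.PosDef.det_re_le_one {ι : Type*} [Fintype ι] [DecidableEq ι] {X : Matrix ι ι ℂ}
    (hX : X.PosDef) (htr : X.trace = Fintype.card ι) : X.det.re ≤ 1 := by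
  have htr' : ∑ i, hX.isHermitian.eigenvalues i = Fintype.card ι := by
    have := hX.isHermitian.trace_eq_sum_eigenvalues
    rw [htr] at this
    exact Complex.ofReal_injective (by simpa using this.symm)
  rw [hX.isHermitian.det_eq_prod_eigenvalues]
  calc (∏ i, (hX.isHermitian.eigenvalues i : ℂ)).re
      = ∏ i, hX.isHermitian.eigenvalues i := by
        rw [← Complex.ofReal_prod, Complex.ofReal_re]
    _ ≤ ∏ i, Real.exp (hX.isHermitian.eigenvalues i - 1) :=
        Finset.prod_le_prod (fun i _ => (hX.eigenvalues_pos i).le) fun i _ => by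
          simpa using Real.add_one_le_exp (hX.isHermitian.eigenvalues i - 1)
    _ = 1 := by
        rw [← Real.exp_sum, Finset.sum_sub_distrib, htr']
        simp

lemma sInf_eq_of_subset_of_forall_exists_le {s t : Set ℝ} (hst : s ⊆ t) (hs : s.Nonempty)
    (ht : BddBelow t) (h : ∀ x ∈ t, ∃ y ∈ s, y ≤ x) : sInf s = sInf t := by
  refine le_antisymm (le_csInf (hs.mono hst) fun x hx => ?_) (csInf_le_csInf ht hs hst)
  obtain ⟨y, hy, hyx⟩ := h x hx
  exact (csInf_le (ht.mono hst) hy).trans hyx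

lemma UT.Gmap_mul_conjTranspose_posDef {k : ℕ} {g : Matrix (Fin k) (Fin k) ℂ} (hg : UT g)
    (hdet : IsUnit g.det) (lam : Fin k → ℕ) : (Gmap lam g * (Gmap lam g)ᴴ).PosDef :=
  Matrix.PosDef.mul_conjTranspose_self _
    (Matrix.vecMul_injective_of_isUnit (hg.isUnit_Gmap hdet lam))

/-- Lemma: the restricted capacity of `trun_{P,Q}T` (infimum only over `h = G_p(h₀)` with `h₀`
invertible upper triangular) equals the full Gurvits capacity of `trun_{P,Q}T`. -/
theorem stmt7 {n m r N : ℕ} (A : Fin r → Matrix (Fin m) (Fin n) ℂ)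
    (p : Fin n → ℕ) (q : Fin m → ℕ)
    (hp : Antitone p) (hp0 : ∀ j, 0 < p j) (hq : Antitone q) (hq0 : ∀ i, 0 < q i)
    (hpN : ∑ j, p j = N) (hqN : ∑ i, q i = N) :
    sInf { x : ℝ | ∃ h₀ : Matrix (Fin n) (Fin n) ℂ, IsUnit h₀.det ∧ UT h₀ ∧
        x = (trun A p q (Gmap p h₀ * (Gmap p h₀)ᴴ)).det.re /
            (Gmap p h₀ * (Gmap p h₀)ᴴ).det.re }
      = sInf { x : ℝ | ∃ X : Matrix (lamIdx p) (lamIdx p) ℂ, X.PosDef ∧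
          x = (trun A p q X).det.re / X.det.re } := by
  have hnum : ∀ X : Matrix (lamIdx p) (lamIdx p) ℂ, X.PosDef → 0 ≤ (trun A p q X).det.re :=
    fun X hX => (Complex.nonneg_iff.1 (Gmap_posSemidef q (cpMap_posSemidef A
      (GmapAdj_posDef p hp0 hX).posSemidef)).det_nonneg).1
  have hden : ∀ X : Matrix (lamIdx p) (lamIdx p) ℂ, X.PosDef → 0 < X.det.re :=
    fun X hX => (Complex.pos_iff.1 hX.det_pos).1
  refine sInf_eq_of_subset_of_forall_exists_le ?_ ?_ ?_ ?_
  · rintro x ⟨h₀, hdet, hUT, rfl⟩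
    exact ⟨_, hUT.Gmap_mul_conjTranspose_posDef hdet p, rfl⟩
  · exact ⟨_, 1, by simp, fun i j hij => Matrix.one_apply_ne hij.ne', rfl⟩
  · refine ⟨0, ?_⟩
    rintro x ⟨X, hX, rfl⟩
    exact div_nonneg (hnum X hX) (hden X hX).le
  · rintro x ⟨X, hX, rfl⟩
    have hP : (GmapAdj p 1).PosDef := GmapAdj_posDef p hp0 Matrix.PosDef.one
    obtain ⟨g, hgdet, hgUT, hg⟩ := exists_UT_conj_eq_diagonal (GmapAdj_posDef p hp0 hX)
      (d := (GmapAdj p 1).diag) fun j => hP.diag_pos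
    rw [← GmapAdj_one_eq_diagonal] at hg
    have hiUT : UT g⁻¹ := hgUT.inv hgdet
    have hidet : IsUnit (g⁻¹).det := Matrix.isUnit_nonsing_inv_det g hgdet
    set Y := Gmap p g * X * (Gmap p g)ᴴ with hY
    have hYpos : Y.PosDef := hX.mul_mul_conjTranspose_same
      (Matrix.vecMul_injective_of_isUnit (hgUT.isUnit_Gmap hgdet p))
    have hYadj : GmapAdj p Y = GmapAdj p 1 := (hgUT.GmapAdj_conj p X).trans hg
    have hYdet : Y.det.re ≤ 1 := by
      refine hYpos.det_re_le_one ?_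
      rw [← trace_GmapAdj, hYadj, trace_GmapAdj, Matrix.trace_one]
    have hXY : X = Gmap p g⁻¹ * Y * (Gmap p g⁻¹)ᴴ := by
      have e : Gmap p g⁻¹ * Gmap p g = 1 := by
        rw [← hgUT.Gmap_mul, Matrix.nonsing_inv_mul _ hgdet, Gmap_one]
      calc X = (Gmap p g⁻¹ * Gmap p g) * X * (Gmap p g⁻¹ * Gmap p g)ᴴ := by simp [e]
        _ = Gmap p g⁻¹ * Y * (Gmap p g⁻¹)ᴴ := by
          simp only [hY, Matrix.conjTranspose_mul, Matrix.mul_assoc]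
    set W := Gmap p g⁻¹ * (Gmap p g⁻¹)ᴴ with hW
    have hWpos : W.PosDef := hiUT.Gmap_mul_conjTranspose_posDef hidet p
    have hadj : GmapAdj p W = GmapAdj p X := by
      rw [hXY, hiUT.GmapAdj_conj, hYadj, ← hiUT.GmapAdj_conj, Matrix.mul_one]
    have htrun : trun A p q W = trun A p q X := by rw [trun, trun, hadj]
    have hXdet : X.det.re ≤ W.det.re := by
      have hmul : X.det = W.det * Y.det := by
        conv_lhs => rw [hXY]
        rw [hW]
        simp only [Matrix.det_mul]
        ring
      rw [hmul, Complex.mul_re, ← (Complex.pos_iff.1 hWpos.det_pos).2, zero_mul, sub_zero]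
      exact mul_le_of_le_one_right (hden W hWpos).le hYdet
    refine ⟨_, ⟨g⁻¹, hidet, hiUT, rfl⟩, ?_⟩
    rw [← hW, htrun]
    exact div_le_div_of_nonneg_left (hnum X hX) (hden X hX) hXdet
end
end

section
/- Let T, p, q, P, Q be as in the setup with p_n > 0 and q_m > 0, and suppose T(P) = I_m, Tr(P) = Tr(Q) = 1, and ds_{P,Q}(T) ≥ ε > 0. If h ∈ Mat_n(ℂ) is invertible upper-triangular with h† T*(Q) h = I_n, then det(P, h† h) ≥ e^{0.3·min{ε, p_n}}. -/
open Matrix BigOperators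

noncomputable section

lemma proj_mul_mul_conjTranspose {j k : ℕ} (hjk : j ≤ k) (X : Matrix (Fin k) (Fin k) ℂ) :
    proj j k * X * (proj j k)ᴴ = X.submatrix (Fin.castLE hjk) (Fin.castLE hjk) := by
  have key : ∀ (i : Fin j) (l : Fin k), proj j k i l = if l = Fin.castLE hjk i then 1 else 0 := by
    intro i l
    simp only [proj, Matrix.of_apply, Fin.ext_iff, Fin.val_castLE, eq_comm]
  ext i l
  simp [Matrix.mul_apply, key]

lemma submatrix_mul_of_zero {ι κ α : Type*} [Fintype ι] [Fintype κ] {e : κ → ι}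
    (he : Function.Injective e) (f : α → ι) (X Y : Matrix ι ι ℂ)
    (hY : ∀ b ∉ Set.range e, ∀ l, Y b (e l) = 0) :
    (X * Y).submatrix f e = X.submatrix f e * Y.submatrix e e := by
  ext i l
  simp only [Matrix.submatrix_apply, Matrix.mul_apply]
  refine (Fintype.sum_of_injective e he _ _ (fun b hb => ?_) fun _ => rfl).symm
  rw [hY b hb l, mul_zero]

lemma UT.apply_eq_zero_of_notMem_range {j k : ℕ} (hjk : j ≤ k) {h : Matrix (Fin k) (Fin k) ℂ}
    (hh : UT h) (b : Fin k) (hb : b ∉ Set.range (Fin.castLE hjk)) (l : Fin j) :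
    h b (Fin.castLE hjk l) = 0 := by
  refine hh _ _ ?_
  rw [Fin.lt_def, Fin.val_castLE]
  by_contra! hlt
  exact hb ⟨⟨b, hlt.trans_lt l.2⟩, rfl⟩

/-- The leading minors of `hᴴ * h` are inverse to those of `M` when `hᴴ * M * h = 1` and `h` is
upper triangular. -/
lemma det_submatrix_mul_det_submatrix {j k : ℕ} (hjk : j ≤ k)
    {h M : Matrix (Fin k) (Fin k) ℂ} (hh : UT h) (hM : hᴴ * M * h = 1) :
    ((hᴴ * h).submatrix (Fin.castLE hjk) (Fin.castLE hjk)).det *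
      (M.submatrix (Fin.castLE hjk) (Fin.castLE hjk)).det = 1 := by
  set e := Fin.castLE hjk with he
  have hinj : Function.Injective e := Fin.castLE_injective hjk
  have hz := hh.apply_eq_zero_of_notMem_range hjk
  have h1 : (hᴴ * h).submatrix e e = (h.submatrix e e)ᴴ * h.submatrix e e := by
    rw [submatrix_mul_of_zero hinj e _ _ hz, Matrix.conjTranspose_submatrix]
  have h2 : (hᴴ * M).submatrix e e = (h.submatrix e e)ᴴ * M.submatrix e e := by
    have h3 : hᴴ * M = (Mᴴ * h)ᴴ := by simp
    rw [h3, ← Matrix.conjTranspose_submatrix, submatrix_mul_of_zero hinj e _ _ hz,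
      Matrix.conjTranspose_mul, Matrix.conjTranspose_submatrix, Matrix.conjTranspose_submatrix,
      Matrix.conjTranspose_conjTranspose]
  have h4 : (h.submatrix e e)ᴴ * M.submatrix e e * h.submatrix e e = 1 := by
    rw [← h2, ← submatrix_mul_of_zero hinj e _ _ hz, hM, Matrix.submatrix_one _ hinj]
  have h5 := congrArg Matrix.det h4
  rw [Matrix.det_mul, Matrix.det_mul, Matrix.det_one] at h5
  rw [h1, Matrix.det_mul, ← h5]
  ring

section PosDef

open scoped ComplexOrder

lemma posDef_of_conjTranspose_mul_mul_eq_one {ι : Type*} [Fintype ι] [DecidableEq ι]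
    {h M : Matrix ι ι ℂ} (hh : IsUnit h.det) (hM : hᴴ * M * h = 1) : M.PosDef := by
  have hu : IsUnit h := (Matrix.isUnit_iff_isUnit_det h).2 hh
  have : M = (h⁻¹)ᴴ * h⁻¹ := by
    have hs : IsUnit (hᴴ).det := by rw [Matrix.det_conjTranspose]; exact hh.star
    calc M = (hᴴ)⁻¹ * (hᴴ * M * h) * h⁻¹ := by
          rw [Matrix.mul_assoc hᴴ, Matrix.nonsing_inv_mul_cancel_left _ _ hs,
            Matrix.mul_nonsing_inv_cancel_right _ _ hh]
      _ = _ := by rw [hM, Matrix.mul_one, Matrix.conjTranspose_nonsing_inv]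
  rw [this]
  refine Matrix.PosDef.conjTranspose_mul_self _ ?_
  rw [Matrix.mulVec_injective_iff_isUnit]
  exact (Matrix.isUnit_nonsing_inv_iff).2 hu

end PosDef

lemma sq_le_sub_one_sub_log {x : ℝ} (hx : 0 < x) (hx2 : x ≤ 2) :
    0.3 * (x - 1) ^ 2 ≤ x - 1 - Real.log x := by
  set g : ℝ → ℝ := fun y => y - 1 - Real.log y - 0.3 * (y - 1) ^ 2 with hg
  have hg1 : g 1 = 0 := by simp [hg]
  have hd : ∀ y, 0 < y → HasDerivAt g ((y - 1) * (y⁻¹ - 0.6)) y := by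
    intro y hy
    have h : HasDerivAt g _ y := (((hasDerivAt_id y).sub_const 1).sub (Real.hasDerivAt_log hy.ne')).sub
      ((((hasDerivAt_id y).sub_const 1).pow 2).const_mul 0.3)
    refine h.congr_deriv ?_
    simp only [id]
    field_simp
    ring
  suffices 0 ≤ g x by simp only [hg] at this; linarith
  rcases le_total x 1 with h1 | h1
  · have hanti : AntitoneOn g (Set.Icc x 1) := by
      refine antitoneOn_of_hasDerivWithinAt_nonpos (convex_Icc x 1)
        (fun y hy => (hd y (hx.trans_le hy.1)).continuousAt.continuousWithinAt)
        (fun y hy => (hd y (hx.trans_le (interior_subset hy).1)).hasDerivWithinAt)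
        fun y hy => ?_
      have hy' := interior_subset hy
      have hy1 : 1 ≤ y⁻¹ := (one_le_inv₀ (hx.trans_le hy'.1)).2 hy'.2
      exact mul_nonpos_of_nonpos_of_nonneg (by linarith [hy'.2]) (by norm_num; linarith)
    exact hg1 ▸ hanti ⟨le_rfl, h1⟩ ⟨h1, le_rfl⟩ h1
  rcases le_total x (5 / 3) with h2 | h2
  · have hmono : MonotoneOn g (Set.Icc 1 x) := by
      have h0 : ∀ y ∈ Set.Icc 1 x, 0 < y := fun y hy => one_pos.trans_le hy.1
      refine monotoneOn_of_hasDerivWithinAt_nonneg (convex_Icc 1 x)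
        (fun y hy => (hd y (h0 y hy)).continuousAt.continuousWithinAt)
        (fun y hy => (hd y (h0 y (interior_subset hy))).hasDerivWithinAt)
        fun y hy => ?_
      have hy' := interior_subset hy
      have hy1 : (5 / 3 : ℝ)⁻¹ ≤ y⁻¹ := inv_anti₀ (h0 y hy') (hy'.2.trans h2)
      exact mul_nonneg (by linarith [hy'.1]) (by norm_num at hy1 ⊢; linarith)
    exact hg1 ▸ hmono ⟨le_rfl, h1⟩ ⟨h1, le_rfl⟩ h1
  · have h3 := Real.log_le_sub_one_of_pos (show 0 < x / 2 by positivity)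
    have h4 : Real.log x = Real.log 2 + Real.log (x / 2) := by
      rw [← Real.log_mul (by norm_num) (by positivity)]; congr 1; ring
    have h5 := Real.log_two_lt_d9
    simp only [hg]
    norm_num at h5 ⊢
    nlinarith

lemma le_sub_one_sub_log {x : ℝ} (hx2 : 2 ≤ x) : 0.3 ≤ x - 1 - Real.log x := by
  have h1 : Real.log x = Real.log 2 + Real.log (x / 2) := by
    rw [← Real.log_mul (by norm_num) (by positivity)]; congr 1; ring
  have h2 := Real.log_le_sub_one_of_pos (show 0 < x / 2 by positivity)
  have h3 := Real.log_two_lt_d9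
  norm_num at h3 ⊢
  linarith

section Spectral

open scoped ComplexOrder

lemma frob_sq {ι κ : Type*} [Fintype ι] [Fintype κ] (X : Matrix ι κ ℂ) : frob X ^ 2 = (X * Xᴴ).trace.re := by
  refine Real.sq_sqrt ?_
  exact (Complex.le_def.1 (Matrix.posSemidef_self_mul_conjTranspose X).trace_nonneg).1

variable {ι : Type*} [Fintype ι] [DecidableEq ι] {M : Matrix ι ι ℂ}

lemma Matrix.IsHermitian.exists_unitary_diagonalization (hM : M.IsHermitian) :
    ∃ U : Matrix ι ι ℂ, star U * U = 1 ∧ U * star U = 1 ∧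
      M = U * Matrix.diagonal (fun i => (hM.eigenvalues i : ℂ)) * star U := by
  refine ⟨hM.eigenvectorUnitary, Unitary.coe_star_mul_self hM.eigenvectorUnitary,
    Unitary.coe_mul_star_self hM.eigenvectorUnitary, ?_⟩
  have := hM.spectral_theorem
  rw [Unitary.conjStarAlgAut_apply] at this
  exact this

lemma trace_sub_card_sub_log_det (hM : M.PosDef) :
    M.trace.re - Fintype.card ι - Real.log M.det.re =
      ∑ i, (hM.isHermitian.eigenvalues i - 1 - Real.log (hM.isHermitian.eigenvalues i)) := by
  have h1 : M.trace.re = ∑ i, hM.isHermitian.eigenvalues i := by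
    rw [hM.isHermitian.trace_eq_sum_eigenvalues]; simp
  have h2 : M.det.re = ∏ i, hM.isHermitian.eigenvalues i := by
    rw [hM.isHermitian.det_eq_prod_eigenvalues, ← RCLike.ofReal_prod]
    exact RCLike.ofReal_re (K := ℂ) _
  rw [h1, h2, Real.log_prod fun i _ => (hM.eigenvalues_pos i).ne']
  simp [Finset.sum_sub_distrib]

lemma frob_sub_one_sq (hM : M.IsHermitian) :
    frob (M - 1) ^ 2 = ∑ i, (hM.eigenvalues i - 1) ^ 2 := by
  obtain ⟨U, hU, -, hs⟩ := hM.exists_unitary_diagonalization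
  set D : Matrix ι ι ℂ := Matrix.diagonal fun i => (hM.eigenvalues i : ℂ)
  have h1 : M * M = U * (D * D) * star U := by
    calc M * M = U * D * (star U * U) * D * star U := by
          conv_lhs => rw [hs]
          simp only [Matrix.mul_assoc]
      _ = _ := by rw [hU]; simp only [Matrix.mul_assoc, Matrix.one_mul]
  have h2 : (M * M).trace = ∑ i, (hM.eigenvalues i : ℂ) ^ 2 := by
    rw [h1, Matrix.trace_mul_comm, ← Matrix.mul_assoc, hU, Matrix.one_mul,
      Matrix.diagonal_mul_diagonal, Matrix.trace_diagonal]
    simp only [sq]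
  have h3 : (M - 1) * (M - 1)ᴴ = M * M - M - M + 1 := by
    rw [Matrix.conjTranspose_sub, hM.eq, Matrix.conjTranspose_one]
    noncomm_ring
  rw [frob_sq, h3, Matrix.trace_add, Matrix.trace_sub, Matrix.trace_sub, h2,
    hM.trace_eq_sum_eigenvalues, Matrix.trace_one]
  have h4 : ∀ x : ℝ, (x - 1) ^ 2 = x ^ 2 - x - x + 1 := fun x => by ring
  simp [h4, Finset.sum_sub_distrib, Finset.sum_add_distrib, ← Complex.ofReal_pow]

lemma posSemidef_two_sub_iff (hM : M.IsHermitian) :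
    (2 - M).PosSemidef ↔ ∀ i, hM.eigenvalues i ≤ 2 := by
  obtain ⟨U, -, hU', hs⟩ := hM.exists_unitary_diagonalization
  set D : Matrix ι ι ℂ := Matrix.diagonal fun i => (hM.eigenvalues i : ℂ)
  have h1 : 2 - M = U * (2 - D) * star U := by
    rw [Matrix.mul_sub, Matrix.sub_mul, ← hs, mul_two, Matrix.add_mul, hU', one_add_one_eq_two]
  have h2 : 2 - D = Matrix.diagonal fun i => ((2 - hM.eigenvalues i : ℝ) : ℂ) := by
    ext i j
    by_cases hij : i = j
    · subst hij; simp [D, Matrix.ofNat_apply]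
    · simp [D, Matrix.ofNat_apply, hij]
  rw [h1, Matrix.IsUnit.posSemidef_star_right_conjugate_iff
    (isUnit_iff_exists_inv.2 ⟨star U, hU'⟩), h2, Matrix.posSemidef_diagonal_iff]
  simp only [Complex.zero_le_real, sub_nonneg]

lemma trace_sub_card_sub_log_det_nonneg (hM : M.PosDef) :
    0 ≤ M.trace.re - Fintype.card ι - Real.log M.det.re := by
  rw [trace_sub_card_sub_log_det hM]
  exact Finset.sum_nonneg fun i _ =>
    sub_nonneg.2 (Real.log_le_sub_one_of_pos (hM.eigenvalues_pos i))

lemma frob_sq_le_trace_sub_card_sub_log_det (hM : M.PosDef)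
    (h2 : (2 - M).PosSemidef) :
    0.3 * frob (M - 1) ^ 2 ≤ M.trace.re - Fintype.card ι - Real.log M.det.re := by
  rw [trace_sub_card_sub_log_det hM, frob_sub_one_sq hM.isHermitian, Finset.mul_sum]
  refine Finset.sum_le_sum fun i _ => sq_le_sub_one_sub_log (hM.eigenvalues_pos i)
    ((posSemidef_two_sub_iff hM.isHermitian).1 h2 i)

lemma le_trace_sub_card_sub_log_det (hM : M.PosDef) (h2 : ¬ (2 - M).PosSemidef) :
    0.3 ≤ M.trace.re - Fintype.card ι - Real.log M.det.re := by
  rw [posSemidef_two_sub_iff hM.isHermitian] at h2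
  push Not at h2
  obtain ⟨i, hi⟩ := h2
  rw [trace_sub_card_sub_log_det hM]
  refine (le_sub_one_sub_log hi.le).trans ?_
  exact Finset.single_le_sum (f := fun i => hM.isHermitian.eigenvalues i - 1 -
      Real.log (hM.isHermitian.eigenvalues i)) (fun i _ =>
    sub_nonneg.2 (Real.log_le_sub_one_of_pos (hM.eigenvalues_pos i))) (Finset.mem_univ i)

end Spectral

lemma delta_nonneg {k : ℕ} {a : Fin k → ℝ} (ha : Antitone a) (ha0 : ∀ j, 0 ≤ a j) (j : Fin k) :
    0 ≤ delta a j := by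
  unfold delta
  split_ifs with h
  · exact sub_nonneg.2 (ha (by simp [Fin.le_def]))
  · simpa using ha0 j

lemma sum_delta_mul_sum {k : ℕ} (a c : Fin k → ℝ) :
    ∑ j : Fin k, delta a j * ∑ i : Fin ((j : ℕ) + 1), c (Fin.castLE j.2 i) = ∑ i, a i * c i := by
  set b : ℕ → ℝ := fun j => if h : j < k then a ⟨j, h⟩ else 0 with hb
  set d : ℕ → ℝ := fun j => if h : j < k then c ⟨j, h⟩ else 0 with hd
  have hdelta : ∀ j : Fin k, delta a j = b j - b (j + 1) := fun j => by simp [delta, hb]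
  have hsum : ∀ j : Fin k, ∑ i : Fin ((j : ℕ) + 1), c (Fin.castLE j.2 i) =
      ∑ i ∈ Finset.range (j + 1), d i := fun j => by
    rw [← Fin.sum_univ_eq_sum_range]
    refine Finset.sum_congr rfl fun i _ => ?_
    simp only [hd]
    rw [dif_pos (show (i : ℕ) < k by omega)]
    rfl
  have hmain : ∀ N : ℕ, ∑ j ∈ Finset.range N, (b j - b (j + 1)) * ∑ i ∈ Finset.range (j + 1), d i =
      ∑ j ∈ Finset.range N, b j * d j - b N * ∑ i ∈ Finset.range N, d i := by
    intro N
    induction N with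
    | zero => simp
    | succ N ih =>
      rw [Finset.sum_range_succ, ih, Finset.sum_range_succ (fun j => b j * d j),
        Finset.sum_range_succ d]
      ring
  have hbk : b k = 0 := by simp [hb]
  have := hmain k
  rw [hbk, zero_mul, sub_zero, ← Fin.sum_univ_eq_sum_range, ← Fin.sum_univ_eq_sum_range] at this
  simpa [hdelta, hsum, hb, hd] using this

lemma trace_diagonal_mul_cpDual {n m r : ℕ} (A : Fin r → Matrix (Fin m) (Fin n) ℂ)
    (X : Matrix (Fin n) (Fin n) ℂ) (Y : Matrix (Fin m) (Fin m) ℂ) :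
    (X * cpDual A Y).trace = (cpMap A X * Y).trace := by
  simp only [cpDual, cpMap, Matrix.mul_sum, Matrix.sum_mul, Matrix.trace_sum]
  refine Finset.sum_congr rfl fun i _ => ?_
  rw [← Matrix.mul_assoc, Matrix.trace_mul_comm]
  simp only [Matrix.mul_assoc]

/-- Lemma (substantial progress): if `T(P) = I`, `Tr P = Tr Q = 1`, `ds_{P,Q}(T) ≥ ε > 0`, and
`h` is invertible upper triangular with `h† T*(Q) h = I`, then
`det(P, h†h) ≥ e^{0.3 · min(ε, p_n)}`. -/
theorem stmt12 {n m r : ℕ} (hn : 0 < n) (hm : 0 < m)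
    (A : Fin r → Matrix (Fin m) (Fin n) ℂ)
    (p : Fin n → ℝ) (q : Fin m → ℝ)
    (hp : Antitone p) (hp0 : ∀ j, 0 ≤ p j) (hq : Antitone q) (hq0 : ∀ i, 0 ≤ q i)
    (hpn : 0 < p ⟨n - 1, Nat.sub_lt hn Nat.one_pos⟩)
    (hqm : 0 < q ⟨m - 1, Nat.sub_lt hm Nat.one_pos⟩)
    (hTP : cpMap A (Matrix.diagonal fun j => (p j : ℂ)) = 1)
    (hTrP : ∑ j, p j = 1) (hTrQ : ∑ i, q i = 1)
    (ε : ℝ) (hε : 0 < ε) (hds : ε ≤ ds A p q)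
    (h : Matrix (Fin n) (Fin n) ℂ) (hh : IsUnit h.det) (hhu : UT h)
    (hhT : hᴴ * cpDual A (Matrix.diagonal fun i => (q i : ℂ)) * h = 1) :
    Real.exp (0.3 * min ε (p ⟨n - 1, Nat.sub_lt hn Nat.one_pos⟩)) ≤ relDet p (hᴴ * h) := by
  open scoped ComplexOrder in
  set M := cpDual A (Matrix.diagonal fun i => (q i : ℂ)) with hM
  have hMpos : M.PosDef := posDef_of_conjTranspose_mul_mul_eq_one hh hhT
  let N (j : Fin n) : Matrix (Fin ((j : ℕ) + 1)) (Fin ((j : ℕ) + 1)) ℂ :=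
    M.submatrix (Fin.castLE j.2) (Fin.castLE j.2)
  have hNpos (j : Fin n) : (N j).PosDef := hMpos.submatrix (Fin.castLE_injective j.2)
  let φ (j : Fin n) : ℝ := (N j).trace.re - Fintype.card (Fin ((j : ℕ) + 1)) -
    Real.log (N j).det.re
  have hφ (j : Fin n) : 0 ≤ φ j := trace_sub_card_sub_log_det_nonneg (hNpos j)
  have hδ := delta_nonneg hp hp0
  have hdet (j : Fin n) : (N j).det = ((N j).det.re : ℂ) ∧ 0 < (N j).det.re := by
    have := Complex.lt_def.1 (hNpos j).det_pos
    exact ⟨Complex.ext rfl this.2.symm, this.1⟩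
  have hbal : ∑ j, delta p j * (N j).trace.re = ∑ j : Fin n, delta p j *
      Fintype.card (Fin ((j : ℕ) + 1)) := by
    have h1 := sum_delta_mul_sum p fun i => (M i i).re
    have h2 := sum_delta_mul_sum p fun _ => 1
    have h3 := trace_diagonal_mul_cpDual A (Matrix.diagonal fun j => (p j : ℂ))
      (Matrix.diagonal fun i => (q i : ℂ))
    rw [hTP, Matrix.one_mul, ← hM, Matrix.trace_diagonal] at h3
    have h4 := congrArg Complex.re h3
    simp only [Matrix.trace, Matrix.diag, Matrix.diagonal_mul, Complex.re_sum, Complex.re_ofReal_mul,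
      Complex.ofReal_re] at h4
    simp only [mul_one, hTrP, Finset.sum_const, Finset.card_univ, nsmul_eq_mul] at h2
    rw [h2, ← hTrQ, ← h4, ← h1]
    simp [N, Matrix.trace]
  have hrel : relDet p (hᴴ * h) = Real.exp (∑ j, delta p j * φ j) := by
    have h1 : ∑ j, delta p j * φ j = ∑ j, delta p j * -Real.log (N j).det.re := by
      simp only [φ, mul_sub, Finset.sum_sub_distrib, hbal, mul_neg, Finset.sum_neg_distrib]
      ring
    rw [h1, Real.exp_sum]
    refine Finset.prod_congr rfl fun j _ => ?_
    have h2 := det_submatrix_mul_det_submatrix j.2 hhu hhT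
    have h3 : ((hᴴ * h).submatrix (Fin.castLE j.2) (Fin.castLE j.2)).det =
        (((N j).det.re)⁻¹ : ℝ) := by
      rw [Complex.ofReal_inv, ← (hdet j).1]
      exact eq_inv_of_mul_eq_one_left h2
    rw [proj_mul_mul_conjTranspose j.2, h3, Complex.ofReal_re,
      Real.rpow_def_of_pos (inv_pos.2 (hdet j).2), Real.log_inv, mul_comm]
  rw [hrel, Real.exp_le_exp]
  set last : Fin n := ⟨n - 1, Nat.sub_lt hn Nat.one_pos⟩ with hlast
  by_cases h2 : (2 - M).PosSemidef
  · have hds' : ds A p q = ∑ j, delta p j * frob (N j - 1) ^ 2 := by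
      have hfrob : ∀ k, frob (0 : Matrix (Fin k) (Fin k) ℂ) = 0 := fun k => by simp [frob]
      simp only [ds, hTP, sub_self, Matrix.mul_zero, Matrix.zero_mul, hfrob]
      rw [Finset.sum_eq_zero (s := (Finset.univ : Finset (Fin m))) (by simp), add_zero]
      refine Finset.sum_congr rfl fun j _ => ?_
      rw [proj_mul_mul_conjTranspose j.2, Matrix.submatrix_sub]
      simp only [Pi.sub_apply, Matrix.submatrix_one _ (Fin.castLE_injective j.2), ← hM, N]
    calc 0.3 * min ε (p last) ≤ 0.3 * ds A p q := by
          gcongr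
          exact (min_le_left _ _).trans hds
      _ = ∑ j, delta p j * (0.3 * frob (N j - 1) ^ 2) := by
          rw [hds', Finset.mul_sum]
          exact Finset.sum_congr rfl fun j _ => by ring
      _ ≤ _ := by
          refine Finset.sum_le_sum fun j _ => mul_le_mul_of_nonneg_left ?_ (hδ j)
          refine frob_sq_le_trace_sub_card_sub_log_det (hNpos j) ?_
          have h3 : 2 - N j = (2 - M).submatrix (Fin.castLE j.2) (Fin.castLE j.2) := by
            ext a b
            simp [N, Matrix.ofNat_apply, Fin.ext_iff]
          exact h3 ▸ h2.submatrix _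
  · have hδlast : delta p last = p last := by
      have : ¬ (last : ℕ) + 1 < n := by simp only [hlast]; omega
      simp [delta, this]
    have hφlast : 0.3 ≤ φ last := by
      refine le_trace_sub_card_sub_log_det (hNpos last) fun h3 => h2 ?_
      have hlt (i : Fin n) : (i : ℕ) < (last : ℕ) + 1 := by simp only [hlast]; omega
      have h4 := h3.submatrix fun i : Fin n => (⟨i, hlt i⟩ : Fin ((last : ℕ) + 1))
      convert h4 using 1
      ext a b
      simp [N, Matrix.ofNat_apply, Fin.ext_iff]
    calc 0.3 * min ε (p last) ≤ φ last * p last := by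
          gcongr
          exact min_le_right _ _
      _ = delta p last * φ last := by rw [hδlast, mul_comm]
      _ ≤ _ := Finset.single_le_sum (f := fun j => delta p j * φ j)
          (fun j _ => mul_nonneg (hδ j) (hφ j)) (Finset.mem_univ last)
end
end
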